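/- Let n ≥ 3 be odd, ξ = e^{2πi/n}, and M the n×n matrix with ones on the sub- and super-diagonal except that row n-1 has entries 2 in positions 0 and n-2 and 0 elsewhere. For 1 ≤ j ≤ (n-1)/2, the row vector Y_j with Y_j(a) = ξ^{(a+1)j} + ξ^{-(a+1)j} for 0 ≤ a ≤ n-2 and Y_j(n-1) = 1 satisfies Y_j M = (ξ^j + ξ^{-j}) Y_j. -/

import Mathlib

open scoped BigOperators

/-- The McKay matrix of tensoring with the 2-dimensional module for `u_ξ(sl₂)`:
ones on the sub- and super-diagonal, except the last row has 2's in columns `0` and `n-2`. -/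
def McKayM (n : ℕ) : Matrix (Fin n) (Fin n) ℂ := fun a b =>
  if (a : ℕ) = n - 1 then (if (b : ℕ) = 0 ∨ (b : ℕ) = n - 2 then 2 else 0)
  else if (b : ℕ) = (a : ℕ) + 1 ∨ (a : ℕ) = (b : ℕ) + 1 then 1 else 0

/-- The product-to-sum identity `2 cos s · 2 cos t = 2 cos (s + t) + 2 cos (s - t)`, in
exponential form. -/
theorem zpow_add_zpow_neg_mul {K : Type*} [Field K] {z : K} (hz : z ≠ 0) (k l : ℤ) :
    (z ^ k + z ^ (-k)) * (z ^ l + z ^ (-l)) =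
      (z ^ (l + k) + z ^ (-(l + k))) + (z ^ (l - k) + z ^ (-(l - k))) := by
  simp only [add_mul, mul_add, ← zpow_add₀ hz]
  ring_nf

theorem mckay_left_eigenvector (n : ℕ) (hn : 3 ≤ n) (hodd : Odd n)
    (j : ℕ) (hj1 : 1 ≤ j) (hj2 : j ≤ (n - 1) / 2)
    (ξ : ℂ) (hξ : ξ = Complex.exp (2 * Real.pi * Complex.I / n))
    (Y : Fin n → ℂ)
    (hY : ∀ a : Fin n, Y a = if (a : ℕ) = n - 1 then 1
      else ξ ^ ((((a : ℕ) + 1) * j : ℕ) : ℤ) + ξ ^ (-((((a : ℕ) + 1) * j : ℕ) : ℤ))) :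
    Matrix.vecMul Y (McKayM n) = (ξ ^ (j : ℤ) + ξ ^ (-(j : ℤ))) • Y := by
  have hn0 : (n : ℂ) ≠ 0 := by exact_mod_cast (by omega : n ≠ 0)
  have hξ0 : ξ ≠ 0 := hξ ▸ Complex.exp_ne_zero _
  have hξn : ξ ^ n = 1 := hξ ▸ (Complex.isPrimitiveRoot_exp n (by omega)).pow_eq_one
  obtain ⟨z, hz⟩ : ∃ z, z = ξ ^ j := ⟨_, rfl⟩
  have hz0 : z ≠ 0 := hz ▸ pow_ne_zero _ hξ0
  have hzn : z ^ (n : ℤ) = 1 := by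
    rw [hz, zpow_natCast, ← pow_mul, mul_comm, pow_mul, hξn, one_pow]
  have hrefl : ∀ k : ℤ, z ^ (n - k) + z ^ (-(n - k)) = z ^ k + z ^ (-k) := by
    intro k
    rw [neg_sub, zpow_sub₀ hz0, zpow_sub₀ hz0, hzn, zpow_neg]
    simp [add_comm]
  have hYlast : ∀ a : Fin n, (a : ℕ) = n - 1 → Y a = 1 := fun a ha => by rw [hY, if_pos ha]
  have hYz : ∀ a : Fin n, (a : ℕ) ≠ n - 1 → ∀ k : ℤ, k = (a : ℕ) + 1 →
      Y a = z ^ k + z ^ (-k) := by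
    intro a ha k hk
    rw [hY, if_neg ha, hk, hz, ← zpow_natCast, ← zpow_mul, ← zpow_mul]
    push_cast
    ring_nf
  have hev : ξ ^ (j : ℤ) + ξ ^ (-(j : ℤ)) = z ^ (1 : ℤ) + z ^ (-1 : ℤ) := by
    simp [hz]
  have htwo : z ^ (0 : ℤ) + z ^ (-0 : ℤ) = 2 := by norm_num
  have hlast : ∀ a b : Fin n, (a : ℕ) = n - 1 →
      McKayM n a b = if (b : ℕ) = 0 ∨ (b : ℕ) = n - 2 then 2 else 0 :=
    fun a b ha => if_pos ha
  have hinner : ∀ a b : Fin n, (a : ℕ) ≠ n - 1 →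
      McKayM n a b = if (b : ℕ) = (a : ℕ) + 1 ∨ (a : ℕ) = (b : ℕ) + 1 then 1 else 0 :=
    fun a b ha => if_neg ha
  have hzero : ∀ a b : Fin n, ((a : ℕ) = n - 1 → (b : ℕ) ≠ 0 ∧ (b : ℕ) ≠ n - 2) →
      ((a : ℕ) ≠ n - 1 → (b : ℕ) ≠ a + 1 ∧ (a : ℕ) ≠ b + 1) → Y a * McKayM n a b = 0 := by
    intro a b h1 h2
    by_cases ha : (a : ℕ) = n - 1
    · rw [hlast a b ha, if_neg (by have := h1 ha; omega), mul_zero]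
    · rw [hinner a b ha, if_neg (by have := h2 ha; omega), mul_zero]
  ext b
  have hb := b.isLt
  rw [hev, Pi.smul_apply, smul_eq_mul, Matrix.vecMul, dotProduct]
  by_cases hb1 : (b : ℕ) = n - 1
  · rw [Fintype.sum_eq_single (⟨n - 2, by omega⟩ : Fin n), hYlast b hb1,
      hYz _ (by simp only; omega) (n - 1) (by simp only; omega),
      hinner _ _ (by simp only; omega), if_pos (by simp only; omega), hrefl]
    intro a ha
    rw [Ne, Fin.ext_iff] at ha
    simp only at ha
    exact hzero a b (by omega) (by omega)
  rw [hYz b hb1 ((b : ℕ) + 1) rfl, zpow_add_zpow_neg_mul hz0]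
  by_cases hb0 : (b : ℕ) = 0
  · rw [Fintype.sum_eq_add (⟨1, by omega⟩ : Fin n) ⟨n - 1, by omega⟩,
      hYz ⟨1, _⟩ (by simp only; omega) ((b : ℕ) + 1 + 1) (by simp only; omega),
      hYlast _ rfl, hlast ⟨n - 1, _⟩ _ rfl, if_pos (Or.inl hb0),
      hinner ⟨1, _⟩ _ (by simp only; omega), if_pos (by simp only; omega), mul_one, one_mul,
      show ((b : ℕ) : ℤ) + 1 - 1 = 0 by omega, htwo]
    · simp only [Ne, Fin.ext_iff]
      omega
    · intro a ha
      simp only [Ne, Fin.ext_iff] at ha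
      exact hzero a b (by omega) (by omega)
  by_cases hb2 : (b : ℕ) = n - 2
  · rw [Fintype.sum_eq_add (⟨n - 3, by omega⟩ : Fin n) ⟨n - 1, by omega⟩,
      hYz ⟨n - 3, _⟩ (by simp only; omega) ((b : ℕ) + 1 - 1) (by simp only; omega),
      hYlast _ rfl, hlast ⟨n - 1, _⟩ _ rfl, if_pos (Or.inr hb2),
      hinner ⟨n - 3, _⟩ _ (by simp only; omega), if_pos (by simp only; omega), mul_one, one_mul,
      show ((b : ℕ) : ℤ) + 1 + 1 = n - 0 by omega, hrefl, htwo, add_comm]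
    · simp only [Ne, Fin.ext_iff]
      omega
    · intro a ha
      simp only [Ne, Fin.ext_iff] at ha
      exact hzero a b (by omega) (by omega)
  · rw [Fintype.sum_eq_add (⟨b + 1, by omega⟩ : Fin n) ⟨b - 1, by omega⟩,
      hYz ⟨b + 1, _⟩ (by simp only; omega) ((b : ℕ) + 1 + 1) (by simp only; omega),
      hYz ⟨b - 1, _⟩ (by simp only; omega) ((b : ℕ) + 1 - 1) (by simp only; omega),
      hinner ⟨b + 1, _⟩ _ (by simp only; omega), if_pos (Or.inr rfl),
      hinner ⟨b - 1, _⟩ _ (by simp only; omega), if_pos (by simp only; omega), mul_one, mul_one]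
    · simp only [Ne, Fin.ext_iff]
      omega
    · intro a ha
      simp only [Ne, Fin.ext_iff] at ha
      exact hzero a b (by omega) (by omega)
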